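/- arXiv:2110.14538 — 3 statements merged into one kernel-verified Lean document; each statement's English description precedes it below -/
import Mathlib

section
/- Let S be a nonempty finite state space, U a finite action set, n ≥ 1 the number of agents, P a transition kernel, r a reward function, γ ∈ [0,1) a discount factor, and π a policy. Suppose that for every state s the reward tensor R(s) : (Fin n → U) → ℝ given by R(s)(u) = r(s,u) has CP-rank at most k₁, and that for every pair of states s, s' the transition tensor P(s,s') : (Fin n → U) → ℝ given by P(s,s')(u) = P(s'|s,u) has CP-rank at most k₂. Then for every state s, the action-value tensor Q^π(s) : (Fin n → U) → ℝ given by u ↦ Q^π(s,u), where Q^π is the unique fixed point of the Bellman expectation operator T^π, has CP-rank at most k₁ + k₂·|S|. -/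
open Finset

/-- A tensor `T : (Fin n → U) → ℝ` has CP-rank at most `k` if it can be written as a sum of
`k` rank-one (outer product) terms. -/
def CPRankLE {U : Type*} [Fintype U] (n k : ℕ) (T : (Fin n → U) → ℝ) : Prop :=
  ∃ (w : Fin k → ℝ) (v : Fin k → Fin n → U → ℝ),
    ∀ u : Fin n → U, T u = ∑ r : Fin k, w r * ∏ i : Fin n, v r i (u i)

/-- The Bellman expectation operator `T^π` for a finite multi-agent MDP. -/
noncomputable def bellmanOp {S U : Type*} [Fintype S] [Fintype U] (n : ℕ)
    (P : S → (Fin n → U) → S → ℝ) (r : S → (Fin n → U) → ℝ) (γ : ℝ)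
    (π : S → (Fin n → U) → ℝ) (Q : S → (Fin n → U) → ℝ) : S → (Fin n → U) → ℝ :=
  fun s u => r s u + γ * ∑ s', P s u s' * ∑ u', π s' u' * Q s' u'

/-- **Tesseract, Theorem 1.** If for every state the reward tensor has CP-rank at most `k₁`
and for every pair of states the transition tensor has CP-rank at most `k₂`, then for every
state the action-value tensor `Q^π(s)` of the unique Bellman fixed point has CP-rank at most
`k₁ + k₂·|S|`. -/
theorem cprank_actionValue_le {S U : Type*} [Fintype S] [Fintype U] [Nonempty S]
    (n : ℕ) (hn : 1 ≤ n)
    (P : S → (Fin n → U) → S → ℝ) (r : S → (Fin n → U) → ℝ) (γ : ℝ)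
    (π : S → (Fin n → U) → ℝ)
    (hP0 : ∀ s u s', 0 ≤ P s u s') (hP1 : ∀ s u, ∑ s', P s u s' = 1)
    (hγ0 : 0 ≤ γ) (hγ1 : γ < 1)
    (hπ0 : ∀ s u, 0 ≤ π s u) (hπ1 : ∀ s, ∑ u, π s u = 1)
    (k₁ k₂ : ℕ)
    (hR : ∀ s, CPRankLE n k₁ (fun u => r s u))
    (hPrank : ∀ s s', CPRankLE n k₂ (fun u => P s u s'))
    (Qπ : S → (Fin n → U) → ℝ) (hQ : bellmanOp n P r γ π Qπ = Qπ) :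
    ∀ s, CPRankLE n (k₁ + k₂ * Fintype.card S) (fun u => Qπ s u) := by
  classical
  intro s
  obtain ⟨w₁, v₁, h₁⟩ := hR s
  choose w₂ v₂ h₂ using hPrank s
  let e : Fin (k₁ + k₂ * Fintype.card S) ≃ Fin k₁ ⊕ (Fin k₂ × S) :=
    Fintype.equivOfCardEq (by simp)
  let c : S → ℝ := fun s' => ∑ u', π s' u' * Qπ s' u'
  let w : Fin k₁ ⊕ (Fin k₂ × S) → ℝ :=
    Sum.elim w₁ (fun p => γ * (w₂ p.2 p.1 * c p.2))
  let v : Fin k₁ ⊕ (Fin k₂ × S) → Fin n → U → ℝ :=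
    Sum.elim v₁ (fun p => v₂ p.2 p.1)
  refine ⟨fun j => w (e j), fun j => v (e j), fun u => ?_⟩
  rw [Equiv.sum_comp e (fun x => w x * ∏ i : Fin n, v x i (u i)), Fintype.sum_sum_type,
    Fintype.sum_prod_type_right]
  have hq : Qπ s u = r s u + γ * ∑ s', P s u s' * c s' := by
    conv_lhs => rw [← hQ]
    rfl
  have h₁u : r s u = _ := h₁ u
  change Qπ s u = _
  rw [hq, h₁u, Finset.mul_sum]
  congr 1
  refine Finset.sum_congr rfl fun s' _ => ?_
  have h₂u : P s u s' = _ := h₂ s' u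
  rw [h₂u, Finset.sum_mul, Finset.mul_sum]
  refine Finset.sum_congr rfl fun j _ => ?_
  simp only [w, v, Sum.elim_inr]
  ring
end

section
/- Let S be a nonempty finite state space, U a finite action set, n ≥ 1, γ ∈ [0,1), π a policy, and r a reward function with 0 ≤ r(s,u) ≤ 1 for all (s,u). Let P and P̄ be two transition kernels (both satisfying P(s'|s,u) ≥ 0 and Σ_{s'} P(s'|s,u) = 1, and likewise for P̄) such that Σ_{s'} |P(s'|s,u) − P̄(s'|s,u)| ≤ δ for all (s,u) ∈ S × U^n. Let Q^π_P and Q^π_{P̄} be the unique fixed points of the corresponding Bellman expectation operators (with the same r and π). Then |Q^π_P(s,u) − Q^π_{P̄}(s,u)| ≤ γ · δ / (2 · (1 − γ)²) for all (s,u) ∈ S × U^n. -/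
open Finset

/-- A convex average of quantities bounded by `M` is bounded by `M`. -/
theorem avg_le_aux {A : Type*} [Fintype A] (p f : A → ℝ) (M : ℝ) (hp0 : ∀ a, 0 ≤ p a)
    (hp1 : ∑ a, p a = 1) (hf : ∀ a, f a ≤ M) : ∑ a, p a * f a ≤ M := by
  calc ∑ a, p a * f a ≤ ∑ a, p a * M :=
        Finset.sum_le_sum fun a _ => mul_le_mul_of_nonneg_left (hf a) (hp0 a)
    _ = M := by rw [← Finset.sum_mul, hp1, one_mul]

/-- Maximum principle for discounted averages. -/
theorem bellman_max_aux {S A : Type*} [Fintype S] [Fintype A] (γ c : ℝ)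
    (hγ0 : 0 ≤ γ) (hγ1 : γ < 1) (π : S → A → ℝ)
    (hπ0 : ∀ s u, 0 ≤ π s u) (hπ1 : ∀ s, ∑ u, π s u = 1)
    (P : S → A → S → ℝ)
    (hP0 : ∀ s u s', 0 ≤ P s u s') (hP1 : ∀ s u, ∑ s', P s u s' = 1)
    (X : S → A → ℝ)
    (hX : ∀ s u, X s u ≤ c + γ * ∑ s', P s u s' * ∑ u', π s' u' * X s' u') :
    ∀ s u, X s u ≤ c / (1 - γ) := by
  intro s u
  haveI : Nonempty (S × A) := ⟨(s, u)⟩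
  obtain ⟨⟨s0, u0⟩, h0⟩ := Finite.exists_max (fun p : S × A => X p.1 p.2)
  have hM : ∀ s u, X s u ≤ X s0 u0 := fun s u => h0 (s, u)
  have h1 : ∑ s', P s0 u0 s' * ∑ u', π s' u' * X s' u' ≤ X s0 u0 :=
    avg_le_aux _ _ _ (hP0 s0 u0) (hP1 s0 u0)
      fun s' => avg_le_aux _ _ _ (hπ0 s') (hπ1 s') (hM s')
  have h2 := hX s0 u0
  have h3 := mul_le_mul_of_nonneg_left h1 hγ0
  refine (hM s u).trans ?_
  rw [le_div_iff₀ (by linarith)]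
  linarith

/-- Difference of two averages, compared against the midpoint of the range `[0, B]`. -/
theorem midpoint_aux {S : Type*} [Fintype S] (p q V : S → ℝ) (B δ : ℝ) (hB : 0 ≤ B)
    (hp : ∑ s, p s = 1) (hq : ∑ s, q s = 1) (hV0 : ∀ s, 0 ≤ V s) (hV1 : ∀ s, V s ≤ B)
    (hd : ∑ s, |p s - q s| ≤ δ) : |∑ s, p s * V s - ∑ s, q s * V s| ≤ δ * (B / 2) := by
  have h : ∑ s, p s * V s - ∑ s, q s * V s = ∑ s, (p s - q s) * (V s - B / 2) := by
    simp only [sub_mul, mul_sub, Finset.sum_sub_distrib, ← Finset.sum_mul, hp, hq]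
    ring
  rw [h]
  calc |∑ s, (p s - q s) * (V s - B / 2)| ≤ ∑ s, |(p s - q s) * (V s - B / 2)| :=
        Finset.abs_sum_le_sum_abs _ _
    _ ≤ ∑ s, |p s - q s| * (B / 2) := by
        refine Finset.sum_le_sum fun s _ => ?_
        rw [abs_mul]
        refine mul_le_mul_of_nonneg_left ?_ (abs_nonneg _)
        rw [abs_le]
        constructor <;> linarith [hV0 s, hV1 s]
    _ ≤ δ * (B / 2) := by
        rw [← Finset.sum_mul]
        exact mul_le_mul_of_nonneg_right hd (by linarith)

/-- **Transition-perturbation bound for policy evaluation.** If rewards lie in `[0,1]` and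
two stochastic kernels satisfy `∑_{s'} |P(s'|s,u) − P̄(s'|s,u)| ≤ δ`, then the corresponding
Bellman fixed points are entrywise within `γ·δ/(2(1−γ)²)`. -/
theorem actionValue_transition_perturbation {S U : Type*} [Fintype S] [Fintype U] [Nonempty S]
    (n : ℕ) (hn : 1 ≤ n)
    (r : S → (Fin n → U) → ℝ) (γ : ℝ)
    (π : S → (Fin n → U) → ℝ)
    (hr : ∀ s u, 0 ≤ r s u ∧ r s u ≤ 1)
    (hγ0 : 0 ≤ γ) (hγ1 : γ < 1)
    (hπ0 : ∀ s u, 0 ≤ π s u) (hπ1 : ∀ s, ∑ u, π s u = 1)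
    (P Pbar : S → (Fin n → U) → S → ℝ)
    (hP0 : ∀ s u s', 0 ≤ P s u s') (hP1 : ∀ s u, ∑ s', P s u s' = 1)
    (hPbar0 : ∀ s u s', 0 ≤ Pbar s u s') (hPbar1 : ∀ s u, ∑ s', Pbar s u s' = 1)
    (δ : ℝ) (hPP : ∀ s u, ∑ s', |P s u s' - Pbar s u s'| ≤ δ)
    (QP QPbar : S → (Fin n → U) → ℝ)
    (hQP : bellmanOp n P r γ π QP = QP)
    (hQPbar : bellmanOp n Pbar r γ π QPbar = QPbar) :
    ∀ s u, |QP s u - QPbar s u| ≤ γ * δ / (2 * (1 - γ) ^ 2) := by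
  have hg : 0 < 1 - γ := by linarith
  have eP : ∀ s u, QP s u = r s u + γ * ∑ s', P s u s' * ∑ u', π s' u' * QP s' u' :=
    fun s u => (congrFun (congrFun hQP s) u).symm
  have eB : ∀ s u, QPbar s u = r s u + γ * ∑ s', Pbar s u s' * ∑ u', π s' u' * QPbar s' u' :=
    fun s u => (congrFun (congrFun hQPbar s) u).symm
  have hup : ∀ s u, QP s u ≤ 1 / (1 - γ) :=
    bellman_max_aux γ 1 hγ0 hγ1 π hπ0 hπ1 P hP0 hP1 QP fun s u => by
      linarith [eP s u, (hr s u).2]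
  have hlo : ∀ s u, -QP s u ≤ 0 / (1 - γ) :=
    bellman_max_aux γ 0 hγ0 hγ1 π hπ0 hπ1 P hP0 hP1 (fun s u => -QP s u) fun s u => by
      simp only [mul_neg, Finset.sum_neg_distrib]
      linarith [eP s u, (hr s u).1]
  have hlo' : ∀ s u, 0 ≤ QP s u := fun s u => by
    have := hlo s u
    rw [zero_div] at this
    linarith
  have hmid : ∀ s u, |∑ s', P s u s' * ∑ u', π s' u' * QP s' u'
      - ∑ s', Pbar s u s' * ∑ u', π s' u' * QP s' u'| ≤ δ * (1 / (1 - γ) / 2) := fun s u =>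
    midpoint_aux _ _ _ _ _ (by positivity) (hP1 s u) (hPbar1 s u)
      (fun s' => Finset.sum_nonneg fun u' _ => mul_nonneg (hπ0 s' u') (hlo' s' u'))
      (fun s' => avg_le_aux _ _ _ (hπ0 s') (hπ1 s') (hup s')) (hPP s u)
  have hc : γ * δ / (2 * (1 - γ) ^ 2) = γ * (δ * (1 / (1 - γ) / 2)) / (1 - γ) := by
    field_simp
  intro s u
  rw [hc, abs_le']
  constructor
  · refine bellman_max_aux γ _ hγ0 hγ1 π hπ0 hπ1 Pbar hPbar0 hPbar1
      (fun s u => QP s u - QPbar s u) (fun s u => ?_) s u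
    simp only [mul_sub, Finset.sum_sub_distrib]
    have h := mul_le_mul_of_nonneg_left (abs_le.1 (hmid s u)).2 hγ0
    linarith [eP s u, eB s u]
  · refine bellman_max_aux γ _ hγ0 hγ1 π hπ0 hπ1 Pbar hPbar0 hPbar1
      (fun s u => -(QP s u - QPbar s u)) (fun s u => ?_) s u
    simp only [neg_sub, mul_sub, Finset.sum_sub_distrib]
    have h := mul_le_mul_of_nonneg_left (abs_le.1 (hmid s u)).1 hγ0
    linarith [eP s u, eB s u]
end

section
/- Let S be a nonempty finite state space, U a finite action set, n ≥ 1, γ ∈ [0,1), and π a policy. Let P be a transition kernel and r a reward function with 0 ≤ r(s,u) ≤ 1 for all (s,u). Let ε ≥ 0 with ε·|S| < 1, let r̄ be an estimated reward with |r̄(s,u) − r(s,u)| ≤ ε for all (s,u), and let P̄(s'|s,u) ≥ 0 be estimated transition weights with |P̄(s'|s,u) − P(s'|s,u)| ≤ ε for all s, s', u. For each (s,u) let f(s,u) = 1/(Σ_{s'} P̄(s'|s,u)) and let P̃(s'|s,u) = f(s,u)·P̄(s'|s,u) be the normalized estimated kernel. Let Q^π_{P,r} and Q^π_{P̃,r̄}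 be the unique fixed points of the Bellman expectation operators for (P, r) and (P̃, r̄) respectively. Then there exists f with 1/(1 + ε·|S|) ≤ f ≤ 1/(1 − ε·|S|) such that for all (s,u) ∈ S × U^n, |Q^π_{P,r}(s,u) − Q^π_{P̃,r̄}(s,u)| ≤ (|1 − f| + f·|S|·ε) · γ / (2·(1 − γ)²) + ε/(1 − γ). -/
open Finset

theorem avg_bound {S U : Type*} [Fintype S] [Fintype U] (n : ℕ)
    (π : S → (Fin n → U) → ℝ)
    (hπ0 : ∀ s u, 0 ≤ π s u) (hπ1 : ∀ s, ∑ u, π s u = 1)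
    (X : S → (Fin n → U) → ℝ) (M : ℝ) (hX : ∀ s u, |X s u| ≤ M) (s : S) :
    |∑ u, π s u * X s u| ≤ M := by
  calc |∑ u, π s u * X s u| ≤ ∑ u, |π s u * X s u| := Finset.abs_sum_le_sum_abs _ _
    _ ≤ ∑ u, π s u * M := by
        refine Finset.sum_le_sum fun u _ => ?_
        rw [abs_mul, abs_of_nonneg (hπ0 s u)]
        exact mul_le_mul_of_nonneg_left (hX s u) (hπ0 s u)
    _ = M := by rw [← Finset.sum_mul, hπ1, one_mul]

theorem fix_bound {S U : Type*} [Fintype S] [Fintype U] (n : ℕ)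
    (γ : ℝ) (hγ0 : 0 ≤ γ) (hγ1 : γ < 1)
    (π : S → (Fin n → U) → ℝ)
    (hπ0 : ∀ s u, 0 ≤ π s u) (hπ1 : ∀ s, ∑ u, π s u = 1)
    (K : S → (Fin n → U) → S → ℝ)
    (hK0 : ∀ s u s', 0 ≤ K s u s') (hK1 : ∀ s u, ∑ s', K s u s' = 1)
    (X g : S → (Fin n → U) → ℝ) (a : ℝ) (hg : ∀ s u, |g s u| ≤ a)
    (hX : ∀ s u, X s u = g s u + γ * ∑ s', K s u s' * ∑ u', π s' u' * X s' u') (s : S)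
    (u : Fin n → U) : |X s u| ≤ a / (1 - γ) := by
  haveI : Nonempty (S × (Fin n → U)) := ⟨(s, u)⟩
  obtain ⟨⟨s0, u0⟩, h0⟩ := Finite.exists_max (fun p : S × (Fin n → U) => |X p.1 p.2|)
  have hM : ∀ s u, |X s u| ≤ |X s0 u0| := fun s u => h0 (s, u)
  refine (hM s u).trans ?_
  have h1 : |∑ s', K s0 u0 s' * ∑ u', π s' u' * X s' u'| ≤ |X s0 u0| := by
    calc _ ≤ ∑ s', |K s0 u0 s' * ∑ u', π s' u' * X s' u'| := Finset.abs_sum_le_sum_abs _ _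
      _ ≤ ∑ s', K s0 u0 s' * |X s0 u0| := by
        refine Finset.sum_le_sum fun s' _ => ?_
        rw [abs_mul, abs_of_nonneg (hK0 s0 u0 s')]
        exact mul_le_mul_of_nonneg_left (avg_bound n π hπ0 hπ1 X _ hM s') (hK0 _ _ _)
      _ = _ := by rw [← Finset.sum_mul, hK1, one_mul]
  have h2 : |X s0 u0| ≤ a + γ * |X s0 u0| := by
    calc |X s0 u0| = |g s0 u0 + γ * ∑ s', K s0 u0 s' * ∑ u', π s' u' * X s' u'| := by
          rw [← hX s0 u0]
      _ ≤ |g s0 u0| + |γ * ∑ s', K s0 u0 s' * ∑ u', π s' u' * X s' u'| := abs_add_le _ _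
      _ ≤ a + γ * |X s0 u0| := by
          rw [abs_mul γ, abs_of_nonneg hγ0]
          exact add_le_add (hg _ _) (mul_le_mul_of_nonneg_left h1 hγ0)
  rw [le_div_iff₀ (by linarith)]
  linarith

/-- **Tesseract, Theorem 3 (policy evaluation error bound).** If the estimated reward `r̄`
and estimated transition weights `P̄` are entrywise within `ε` of the true dynamics
(`0 ≤ r ≤ 1`, `ε·|S| < 1`), and `P̃(s'|s,u) = f(s,u)·P̄(s'|s,u)` is the normalized
estimated kernel with `f(s,u) = 1/∑_{s'} P̄(s'|s,u)`, then there exists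
`f ∈ [1/(1+ε|S|), 1/(1−ε|S|)]` such that the fixed points of the Bellman operators for
`(P,r)` and `(P̃,r̄)` satisfy
`|Q^π_{P,r} − Q^π_{P̃,r̄}| ≤ (|1−f| + f·|S|·ε)·γ/(2(1−γ)²) + ε/(1−γ)` entrywise. -/
theorem policy_evaluation_error_bound {S U : Type*} [Fintype S] [Fintype U] [Nonempty S]
    (n : ℕ) (hn : 1 ≤ n)
    (γ : ℝ) (hγ0 : 0 ≤ γ) (hγ1 : γ < 1)
    (π : S → (Fin n → U) → ℝ)
    (hπ0 : ∀ s u, 0 ≤ π s u) (hπ1 : ∀ s, ∑ u, π s u = 1)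
    (P : S → (Fin n → U) → S → ℝ)
    (hP0 : ∀ s u s', 0 ≤ P s u s') (hP1 : ∀ s u, ∑ s', P s u s' = 1)
    (r : S → (Fin n → U) → ℝ) (hr : ∀ s u, 0 ≤ r s u ∧ r s u ≤ 1)
    (ε : ℝ) (hε : 0 ≤ ε) (hεS : ε * (Fintype.card S : ℝ) < 1)
    (rbar : S → (Fin n → U) → ℝ) (hrbar : ∀ s u, |rbar s u - r s u| ≤ ε)
    (Pbar : S → (Fin n → U) → S → ℝ)
    (hPbar0 : ∀ s u s', 0 ≤ Pbar s u s')
    (hPbar : ∀ s u s', |Pbar s u s' - P s u s'| ≤ ε)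
    (Qtrue Qest : S → (Fin n → U) → ℝ)
    (hQtrue : bellmanOp n P r γ π Qtrue = Qtrue)
    (hQest : bellmanOp n
      (fun s u s' => (∑ t, Pbar s u t)⁻¹ * Pbar s u s') rbar γ π Qest = Qest) :
    ∃ f : ℝ,
      1 / (1 + ε * (Fintype.card S : ℝ)) ≤ f ∧
      f ≤ 1 / (1 - ε * (Fintype.card S : ℝ)) ∧
      ∀ s u, |Qtrue s u - Qest s u| ≤
        (|1 - f| + f * (Fintype.card S : ℝ) * ε) * γ / (2 * (1 - γ) ^ 2) +
          ε / (1 - γ) := by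
  set x : ℝ := ε * (Fintype.card S : ℝ) with hx
  have hx0 : 0 ≤ x := by positivity
  have hx1 : 0 < 1 - x := by linarith
  have hg1 : 0 < 1 - γ := by linarith
  have hsum : ∀ s u, |∑ t, Pbar s u t - 1| ≤ x := by
    intro s u
    rw [← hP1 s u, ← Finset.sum_sub_distrib]
    refine (Finset.abs_sum_le_sum_abs _ _).trans ?_
    refine (Finset.sum_le_sum fun t _ => hPbar s u t).trans ?_
    simp [hx, mul_comm]
  have hpos : ∀ s u, 1 - x ≤ ∑ t, Pbar s u t := fun s u => by
    have := (abs_le.mp (hsum s u)).1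
    linarith
  set Pt : S → (Fin n → U) → S → ℝ := fun s u s' => (∑ t, Pbar s u t)⁻¹ * Pbar s u s' with hPt
  have hPt0 : ∀ s u s', 0 ≤ Pt s u s' := fun s u s' =>
    mul_nonneg (inv_nonneg.mpr (hx1.le.trans (hpos s u))) (hPbar0 s u s')
  have hPt1 : ∀ s u, ∑ s', Pt s u s' = 1 := fun s u => by
    simp only [hPt]
    rw [← Finset.mul_sum]
    exact inv_mul_cancel₀ (hx1.trans_le (hpos s u)).ne'
  have hL1 : ∀ s u, ∑ s', |P s u s' - Pt s u s'| ≤ 2 * x / (1 - x) := by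
    intro s u
    have hσ := hpos s u
    have hσ' := hsum s u
    have hb := hPbar s u
    simp only [hPt]
    generalize (∑ t, Pbar s u t) = σ at *
    have hσ0 : 0 < σ := hx1.trans_le hσ
    have h1 : ∀ s', |P s u s' - σ⁻¹ * Pbar s u s'| ≤ σ⁻¹ * (x * P s u s' + ε) := by
      intro s'
      have : P s u s' - σ⁻¹ * Pbar s u s' =
          σ⁻¹ * ((σ - 1) * P s u s' - (Pbar s u s' - P s u s')) := by
        field_simp
        ring
      rw [this, abs_mul, abs_of_pos (inv_pos.mpr hσ0)]
      refine mul_le_mul_of_nonneg_left ?_ (inv_pos.mpr hσ0).le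
      refine (abs_sub _ _).trans (add_le_add ?_ (hb s'))
      rw [abs_mul, abs_of_nonneg (hP0 s u s')]
      exact mul_le_mul_of_nonneg_right hσ' (hP0 _ _ _)
    refine (Finset.sum_le_sum fun t _ => h1 t).trans ?_
    rw [← Finset.mul_sum, Finset.sum_add_distrib, ← Finset.mul_sum, hP1]
    have h2 : ∑ _t : S, ε = x := by simp [hx, mul_comm]
    rw [h2, div_eq_inv_mul]
    have h3 : σ⁻¹ ≤ (1 - x)⁻¹ := inv_anti₀ hx1 hσ
    calc σ⁻¹ * (x * 1 + x) = σ⁻¹ * (2 * x) := by ring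
      _ ≤ _ := mul_le_mul_of_nonneg_right h3 (by linarith)
  have hT : ∀ s u, Qtrue s u = r s u + γ * ∑ s', P s u s' * ∑ u', π s' u' * Qtrue s' u' :=
    fun s u => (congrFun (congrFun hQtrue s) u).symm
  have hE : ∀ s u, Qest s u = rbar s u + γ * ∑ s', Pt s u s' * ∑ u', π s' u' * Qest s' u' :=
    fun s u => (congrFun (congrFun hQest s) u).symm
  obtain ⟨c, hc⟩ : ∃ c : ℝ, c = 1 / 2 / (1 - γ) := ⟨_, rfl⟩
  have hcγ : c * (1 - γ) = 1 / 2 := by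
    rw [hc]
    field_simp
  have hc0 : 0 ≤ c := by
    rw [hc]
    positivity
  have hQc : ∀ s u, |Qtrue s u - c| ≤ c := by
    intro s u
    have := fix_bound n γ hγ0 hγ1 π hπ0 hπ1 P hP0 hP1 (fun s u => Qtrue s u - c)
      (fun s u => r s u - 1 / 2) (1 / 2)
      (fun s u => abs_le.mpr ⟨by linarith [(hr s u).1], by linarith [(hr s u).2]⟩)
      (fun s u => by
        simp only [mul_sub, Finset.sum_sub_distrib, ← Finset.sum_mul, hπ1, hP1, one_mul]
        have := hT s u
        linarith) s u
    rwa [← hc] at this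
  have hV : ∀ s, |∑ u, π s u * Qtrue s u - c| ≤ c := by
    intro s
    have := avg_bound n π hπ0 hπ1 (fun s u => Qtrue s u - c) c hQc s
    simpa only [mul_sub, Finset.sum_sub_distrib, ← Finset.sum_mul, hπ1, one_mul] using this
  have hD : ∀ s u, |∑ s', (P s u s' - Pt s u s') * ∑ u', π s' u' * Qtrue s' u'| ≤
      2 * x / (1 - x) * c := by
    intro s u
    have e : ∑ s', (P s u s' - Pt s u s') * ∑ u', π s' u' * Qtrue s' u' =
        ∑ s', (P s u s' - Pt s u s') * (∑ u', π s' u' * Qtrue s' u' - c) := by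
      simp only [mul_sub _ _ c, Finset.sum_sub_distrib, ← Finset.sum_mul, hPt1, hP1]
      ring
    rw [e]
    refine (Finset.abs_sum_le_sum_abs _ _).trans ?_
    refine le_trans ?_ (mul_le_mul_of_nonneg_right (hL1 s u) hc0)
    rw [Finset.sum_mul]
    refine Finset.sum_le_sum fun s' _ => ?_
    rw [abs_mul]
    exact mul_le_mul_of_nonneg_left (hV s') (abs_nonneg _)
  refine ⟨1 / (1 - x), one_div_le_one_div_of_le hx1 (by linarith), le_rfl, fun s u => ?_⟩
  have key := fix_bound n γ hγ0 hγ1 π hπ0 hπ1 Pt hPt0 hPt1 (fun s u => Qtrue s u - Qest s u)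
    (fun s u => (r s u - rbar s u) +
      γ * ∑ s', (P s u s' - Pt s u s') * ∑ u', π s' u' * Qtrue s' u')
    (ε + γ * (2 * x / (1 - x) * c))
    (fun s u => by
      refine (abs_add_le _ _).trans (add_le_add ?_ ?_)
      · rw [abs_sub_comm]
        exact hrbar s u
      · rw [abs_mul, abs_of_nonneg hγ0]
        exact mul_le_mul_of_nonneg_left (hD s u) hγ0)
    (fun s u => by
      simp only [sub_mul, mul_sub, Finset.sum_sub_distrib]
      have := hT s u
      have := hE s u
      linarith) s u
  refine key.trans (le_of_eq ?_)
  have hf : |1 - 1 / (1 - x)| = x / (1 - x) := by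
    have : 1 - 1 / (1 - x) = -(x / (1 - x)) := by
      field_simp
      ring
    rw [this, abs_neg, abs_of_nonneg (by positivity)]
  have hm : 1 / (1 - x) * (Fintype.card S : ℝ) * ε = x / (1 - x) := by
    have : x / (1 - x) = ε * (Fintype.card S : ℝ) / (1 - x) := by rw [← hx]
    rw [this]
    ring
  rw [hf, hm, hc]
  field_simp
  ring
end
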